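/- arXiv:math/0604406 — 5 statements merged into one kernel-verified Lean document; each statement's English description precedes it below -/
import Mathlib

section
/- Let K be an algebraically closed field of characteristic zero, R = K[X,Y,Z], and A = R/(X^3, Y^3, Z^3, XYZ). Then for EVERY linear form ℓ ∈ R_1, the multiplication map μ_ℓ : A_2 → A_3 is neither injective nor surjective (here dim_K A_2 = dim_K A_3 = 6). In particular, the Artinian almost complete intersection A does not have the Weak Lefschetz property, answering negatively a question of Migliore and Miró-Roig. -/
open MvPolynomial

/-- The multiplication map `μ_ℓ : A_m → A_{m+1}` on `A = R/I` (with `R = K[X,Y,Z]`)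
induced by a linear form `ℓ` is injective, expressed on representatives. -/
def LefInj {K : Type*} [Field K] (I : Ideal (MvPolynomial (Fin 3) K))
    (ℓ : MvPolynomial (Fin 3) K) (m : ℕ) : Prop :=
  ∀ h : MvPolynomial (Fin 3) K, h.IsHomogeneous m → ℓ * h ∈ I → h ∈ I

/-- The multiplication map `μ_ℓ : A_m → A_{m+1}` on `A = R/I` is surjective,
expressed on representatives. -/
def LefSurj {K : Type*} [Field K] (I : Ideal (MvPolynomial (Fin 3) K))
    (ℓ : MvPolynomial (Fin 3) K) (m : ℕ) : Prop :=
  ∀ g : MvPolynomial (Fin 3) K, g.IsHomogeneous (m + 1) →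
    ∃ h : MvPolynomial (Fin 3) K, h.IsHomogeneous m ∧ g - ℓ * h ∈ I

/-- `A = R/I` has the Weak Lefschetz property. -/
def WeakLefschetz {K : Type*} [Field K] (I : Ideal (MvPolynomial (Fin 3) K)) : Prop :=
  ∃ ℓ : MvPolynomial (Fin 3) K, ℓ ≠ 0 ∧ ℓ.IsHomogeneous 1 ∧
    ∀ m : ℕ, LefInj I ℓ m ∨ LefSurj I ℓ m

/-- The `m`-th graded component `A_m` of `A = R/I`, as the image of the space of
homogeneous polynomials of degree `m` in the quotient. -/
noncomputable def gradedPiece {K : Type*} [Field K] (I : Ideal (MvPolynomial (Fin 3) K))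
    (m : ℕ) : Submodule K (MvPolynomial (Fin 3) K ⧸ I) :=
  (MvPolynomial.homogeneousSubmodule (Fin 3) K m).map (Ideal.Quotient.mkₐ K I).toLinearMap

/-- The exponent vector of `X ^ p * Y ^ q * Z ^ r`. -/
noncomputable def expVec (p q r : ℕ) : Fin 3 →₀ ℕ :=
  Finsupp.equivFunOnFinite.symm ![p, q, r]

@[simp] lemma expVec_zero (p q r : ℕ) : expVec p q r 0 = p := rfl

@[simp] lemma expVec_one (p q r : ℕ) : expVec p q r 1 = q := rfl

@[simp] lemma expVec_two (p q r : ℕ) : expVec p q r 2 = r := rfl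

lemma eq_expVec (d : Fin 3 →₀ ℕ) : d = expVec (d 0) (d 1) (d 2) := by
  ext i; fin_cases i <;> rfl

lemma expVec_inj {p q r p' q' r' : ℕ} :
    expVec p q r = expVec p' q' r' ↔ p = p' ∧ q = q' ∧ r = r' := by
  refine ⟨fun h => ⟨?_, ?_, ?_⟩, ?_⟩
  · simpa using DFunLike.congr_fun h 0
  · simpa using DFunLike.congr_fun h 1
  · simpa using DFunLike.congr_fun h 2
  · rintro ⟨rfl, rfl, rfl⟩; rfl

lemma degree_fin_three (d : Fin 3 →₀ ℕ) : d.degree = d 0 + d 1 + d 2 := by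
  rw [Finsupp.degree_eq_sum, Fin.sum_univ_three]

/-- The exponents of the monomials lying in `(X³, Y³, Z³, XYZ)`. -/
def InMonIdeal (d : Fin 3 →₀ ℕ) : Prop :=
  3 ≤ d 0 ∨ 3 ≤ d 1 ∨ 3 ≤ d 2 ∨ (1 ≤ d 0 ∧ 1 ≤ d 1 ∧ 1 ≤ d 2)

section

variable {K : Type*} [Field K]

lemma monomial_expVec (p q r : ℕ) :
    monomial (expVec p q r) (1 : K) = X 0 ^ p * X 1 ^ q * X 2 ^ r := by
  rw [monomial_eq, Finsupp.prod_fintype _ _ (by simp), Fin.prod_univ_three]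
  simp

/-- The ideal `(X³, Y³, Z³, XYZ)`. -/
noncomputable abbrev monIdeal (K : Type*) [Field K] : Ideal (MvPolynomial (Fin 3) K) :=
  Ideal.span {X 0 ^ 3, X 1 ^ 3, X 2 ^ 3, X 0 * X 1 * X 2}

lemma mem_monIdeal_iff (f : MvPolynomial (Fin 3) K) :
    f ∈ monIdeal K ↔ ∀ d, ¬ InMonIdeal d → coeff d f = 0 := by
  have hI : monIdeal K = Ideal.span ((fun s => monomial s (1 : K)) ''
      {expVec 3 0 0, expVec 0 3 0, expVec 0 0 3, expVec 1 1 1}) := by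
    simp only [Set.image_insert_eq, Set.image_singleton, monomial_expVec]
    simp
  have hle (p q r : ℕ) (d : Fin 3 →₀ ℕ) :
      expVec p q r ≤ d ↔ p ≤ d 0 ∧ q ≤ d 1 ∧ r ≤ d 2 := by
    rw [Finsupp.le_def]
    simp [Fin.forall_fin_succ]
  rw [hI, mem_ideal_span_monomial_image]
  refine forall_congr' fun d => ?_
  simp only [mem_support_iff, Set.mem_insert_iff, Set.mem_singleton_iff, exists_eq_or_imp,
    exists_eq_left, hle, InMonIdeal, zero_le, true_and, and_true]
  tauto

/-- If a family of distinct exponents lists the monomials of degree `m` outside `(X³, Y³, Z³, XYZ)`,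
its length is the dimension of the graded piece of degree `m`. -/
lemma finrank_gradedPiece_monIdeal {n m : ℕ} (e : Fin n → Fin 3 →₀ ℕ)
    (he : Function.Injective e) (hmem : ∀ i, ¬ InMonIdeal (e i)) (hdeg : ∀ i, (e i).degree = m)
    (hall : ∀ d, ¬ InMonIdeal d → d.degree = m → ∃ i, e i = d) :
    Module.finrank K (gradedPiece (monIdeal K) m) = n := by
  let φ := (Ideal.Quotient.mkₐ K (monIdeal K)).toLinearMap
  have hφ (f : MvPolynomial (Fin 3) K) : φ f = 0 ↔ f ∈ monIdeal K :=
    Ideal.Quotient.eq_zero_iff_mem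
  let b : Fin n → MvPolynomial (Fin 3) K ⧸ monIdeal K := fun i => φ (monomial (e i) 1)
  have hcoeff (c : Fin n → K) (i : Fin n) :
      coeff (e i) (∑ j, c j • monomial (e j) (1 : K)) = c i := by
    simp [coeff_sum, coeff_monomial, he.eq_iff]
  have hli : LinearIndependent K b := by
    rw [Fintype.linearIndependent_iff]
    intro c hc i
    have : φ (∑ j, c j • monomial (e j) (1 : K)) = 0 := by
      rw [← hc]; simp [b]
    rw [hφ, mem_monIdeal_iff] at this
    rw [← hcoeff c i]
    exact this _ (hmem i)
  have hspan : gradedPiece (monIdeal K) m = Submodule.span K (Set.range b) := by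
    apply le_antisymm
    · rintro _ ⟨f, hf, rfl⟩
      have hf' : f.IsHomogeneous m := hf
      have key : φ f = ∑ i, coeff (e i) f • b i := by
        have : φ (f - ∑ j, coeff (e j) f • monomial (e j) (1 : K)) = 0 := by
          rw [hφ, mem_monIdeal_iff]
          intro d hd
          by_cases hdm : d.degree = m
          · obtain ⟨i, rfl⟩ := hall d hd hdm
            rw [coeff_sub, hcoeff, sub_self]
          · have hne (j : Fin n) : e j ≠ d := fun h => hdm (h ▸ hdeg j)
            rw [coeff_sub, hf'.coeff_eq_zero hdm]
            simp [coeff_sum, coeff_monomial, hne]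
        rw [map_sub, sub_eq_zero] at this
        rw [this]; simp [b]
      change φ f ∈ _
      rw [key]
      exact Submodule.sum_mem _ fun i _ =>
        Submodule.smul_mem _ _ (Submodule.subset_span ⟨i, rfl⟩)
    · rw [Submodule.span_le]
      rintro _ ⟨i, rfl⟩
      exact ⟨_, isHomogeneous_monomial 1 (hdeg i), rfl⟩
  rw [hspan, finrank_span_eq_card hli, Fintype.card_fin]

lemma finrank_gradedPiece_monIdeal_two :
    Module.finrank K (gradedPiece (monIdeal K) 2) = 6 := by
  refine finrank_gradedPiece_monIdeal ![expVec 2 0 0, expVec 0 2 0, expVec 0 0 2, expVec 1 1 0,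
    expVec 1 0 1, expVec 0 1 1] ?_ ?_ ?_ ?_
  · intro i j h
    fin_cases i <;> fin_cases j <;> simp [expVec_inj] at h ⊢
  · intro i
    fin_cases i <;> simp [InMonIdeal]
  · intro i
    fin_cases i <;> simp [degree_fin_three]
  · intro d hd hdeg
    rw [eq_expVec d] at hd hdeg ⊢
    generalize d 0 = p at *
    generalize d 1 = q at *
    generalize d 2 = r at *
    simp only [degree_fin_three, InMonIdeal, expVec_zero, expVec_one, expVec_two] at hd hdeg
    simp only [Fin.exists_fin_succ, Matrix.cons_val_zero, Matrix.cons_val_succ, expVec_inj,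
      IsEmpty.exists_iff]
    omega

lemma finrank_gradedPiece_monIdeal_three :
    Module.finrank K (gradedPiece (monIdeal K) 3) = 6 := by
  refine finrank_gradedPiece_monIdeal ![expVec 2 1 0, expVec 1 2 0, expVec 2 0 1, expVec 1 0 2,
    expVec 0 2 1, expVec 0 1 2] ?_ ?_ ?_ ?_
  · intro i j h
    fin_cases i <;> fin_cases j <;> simp [expVec_inj] at h ⊢
  · intro i
    fin_cases i <;> simp [InMonIdeal]
  · intro i
    fin_cases i <;> simp [degree_fin_three]
  · intro d hd hdeg
    rw [eq_expVec d] at hd hdeg ⊢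
    generalize d 0 = p at *
    generalize d 1 = q at *
    generalize d 2 = r at *
    simp only [degree_fin_three, InMonIdeal, expVec_zero, expVec_one, expVec_two] at hd hdeg
    simp only [Fin.exists_fin_succ, Matrix.cons_val_zero, Matrix.cons_val_succ, expVec_inj,
      IsEmpty.exists_iff]
    omega

lemma exists_eq_linear_form {ℓ : MvPolynomial (Fin 3) K} (hℓ : ℓ.IsHomogeneous 1) :
    ∃ a b c : K, ℓ = C a * X 0 + C b * X 1 + C c * X 2 := by
  refine ⟨coeff (expVec 1 0 0) ℓ, coeff (expVec 0 1 0) ℓ, coeff (expVec 0 0 1) ℓ, ?_⟩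
  have h0 : (X 0 : MvPolynomial (Fin 3) K) = monomial (expVec 1 0 0) 1 := by
    simp [monomial_expVec]
  have h1 : (X 1 : MvPolynomial (Fin 3) K) = monomial (expVec 0 1 0) 1 := by
    simp [monomial_expVec]
  have h2 : (X 2 : MvPolynomial (Fin 3) K) = monomial (expVec 0 0 1) 1 := by
    simp [monomial_expVec]
  ext d
  rw [h0, h1, h2]
  simp only [coeff_add, coeff_C_mul, coeff_monomial]
  by_cases hd : d.degree = 1
  · rw [eq_expVec d] at hd ⊢
    simp only [degree_fin_three, expVec_zero, expVec_one, expVec_two] at hd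
    obtain ⟨h0, h1, h2⟩ | ⟨h0, h1, h2⟩ | ⟨h0, h1, h2⟩ :
        (d 0 = 1 ∧ d 1 = 0 ∧ d 2 = 0) ∨ (d 0 = 0 ∧ d 1 = 1 ∧ d 2 = 0) ∨
          (d 0 = 0 ∧ d 1 = 0 ∧ d 2 = 1) := by omega
    all_goals simp [h0, h1, h2, expVec_inj]
  · have hne (p q r : ℕ) (h : p + q + r = 1) : expVec p q r ≠ d := by
      rintro rfl; simp [degree_fin_three, h] at hd
    simp [hℓ.coeff_eq_zero hd, hne]

lemma not_lefInj_monIdeal (a b c : K) :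
    ¬ LefInj (monIdeal K) (C a * X 0 + C b * X 1 + C c * X 2) 2 := by
  intro hinj
  have hmon {f : MvPolynomial (Fin 3) K} (hf : f ∈ monIdeal K) (d : Fin 3 →₀ ℕ)
      (hd : ¬ InMonIdeal d) : coeff d f = 0 := (mem_monIdeal_iff f).1 hf d hd
  by_cases h0 : a = 0 ∧ b = 0 ∧ c = 0
  · obtain ⟨rfl, rfl, rfl⟩ := h0
    have hX := hinj (monomial (expVec 2 0 0) 1)
      (isHomogeneous_monomial 1 (by simp [degree_fin_three])) (by simp)
    simpa using hmon hX (expVec 2 0 0) (by simp [InMonIdeal])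
  let h : MvPolynomial (Fin 3) K :=
    monomial (expVec 2 0 0) (a ^ 2) + monomial (expVec 0 2 0) (b ^ 2) +
    monomial (expVec 0 0 2) (c ^ 2) + monomial (expVec 1 1 0) (-(a * b)) +
    monomial (expVec 1 0 1) (-(a * c)) + monomial (expVec 0 1 1) (-(b * c))
  have hmul : (C a * X 0 + C b * X 1 + C c * X 2) * h =
      C (a ^ 3) * X 0 ^ 3 + C (b ^ 3) * X 1 ^ 3 + C (c ^ 3) * X 2 ^ 3 +
        C (-3 * a * b * c) * (X 0 * X 1 * X 2) := by
    have hC (d : Fin 3 →₀ ℕ) (k : K) : monomial d k = C k * monomial d 1 := by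
      rw [C_mul_monomial, mul_one]
    simp only [h]
    rw [hC _ (a ^ 2), hC _ (b ^ 2), hC _ (c ^ 2), hC _ (-(a * b)), hC _ (-(a * c)),
      hC _ (-(b * c))]
    simp only [monomial_expVec, map_neg, map_mul, map_pow, map_ofNat]
    ring
  have hmem : h ∈ monIdeal K := by
    refine hinj h ?_ ?_
    · have hm (p q r : ℕ) (k : K) (hs : p + q + r = 2) :
          (monomial (expVec p q r) k).IsHomogeneous 2 :=
        isHomogeneous_monomial k (by simpa [degree_fin_three] using hs)
      exact (((((hm _ _ _ _ rfl).add (hm _ _ _ _ rfl)).add (hm _ _ _ _ rfl)).add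
        (hm _ _ _ _ rfl)).add (hm _ _ _ _ rfl)).add (hm _ _ _ _ rfl)
    · rw [hmul]
      refine Ideal.add_mem _ (Ideal.add_mem _ (Ideal.add_mem _ ?_ ?_) ?_) ?_ <;>
        exact Ideal.mul_mem_left _ _ (Ideal.subset_span (by simp))
  have ha := hmon hmem (expVec 2 0 0) (by simp [InMonIdeal])
  have hb := hmon hmem (expVec 0 2 0) (by simp [InMonIdeal])
  have hc := hmon hmem (expVec 0 0 2) (by simp [InMonIdeal])
  simp [h, coeff_monomial, expVec_inj] at ha hb hc
  exact h0 ⟨ha, hb, hc⟩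

lemma not_lefSurj_monIdeal (a b c : K) :
    ¬ LefSurj (monIdeal K) (C a * X 0 + C b * X 1 + C c * X 2) 2 := by
  intro hsurj
  have hsub (p q r : ℕ) : expVec p q r - Finsupp.single 0 1 = expVec (p - 1) q r ∧
      expVec p q r - Finsupp.single 1 1 = expVec p (q - 1) r ∧
      expVec p q r - Finsupp.single 2 1 = expVec p q (r - 1) := by
    refine ⟨?_, ?_, ?_⟩ <;> ext i <;> fin_cases i <;> simp
  have hcoeff (h : MvPolynomial (Fin 3) K) (p q r : ℕ) :
      coeff (expVec p q r) ((C a * X 0 + C b * X 1 + C c * X 2) * h) =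
        (if p ≠ 0 then a * coeff (expVec (p - 1) q r) h else 0) +
        (if q ≠ 0 then b * coeff (expVec p (q - 1) r) h else 0) +
        (if r ≠ 0 then c * coeff (expVec p q (r - 1)) h else 0) := by
    simp only [add_mul, mul_assoc, coeff_add, coeff_C_mul, coeff_X_mul', hsub,
      Finsupp.mem_support_iff, expVec_zero, expVec_one, expVec_two, mul_ite, mul_zero]
  have key (g : MvPolynomial (Fin 3) K) (hg : g.IsHomogeneous 3) :
      b * c ^ 2 * coeff (expVec 2 1 0) g - a * c ^ 2 * coeff (expVec 1 2 0) g -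
        b ^ 2 * c * coeff (expVec 2 0 1) g + a * b ^ 2 * coeff (expVec 1 0 2) g +
        a ^ 2 * c * coeff (expVec 0 2 1) g - a ^ 2 * b * coeff (expVec 0 1 2) g = 0 ∧
      (a = 0 → b = 0 → coeff (expVec 2 1 0) g = 0) ∧
      (a = 0 → c = 0 → coeff (expVec 1 0 2) g = 0) ∧
      (b = 0 → c = 0 → coeff (expVec 0 2 1) g = 0) := by
    obtain ⟨h, -, hI⟩ := hsurj g hg
    rw [mem_monIdeal_iff] at hI
    have hI' (p q r : ℕ) (hd : ¬ InMonIdeal (expVec p q r)) :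
        coeff (expVec p q r) g =
          (if p ≠ 0 then a * coeff (expVec (p - 1) q r) h else 0) +
          (if q ≠ 0 then b * coeff (expVec p (q - 1) r) h else 0) +
          (if r ≠ 0 then c * coeff (expVec p q (r - 1)) h else 0) := by
      rw [← hcoeff, ← sub_eq_zero, ← coeff_sub]
      exact hI _ hd
    rw [hI' 2 1 0 (by simp [InMonIdeal]), hI' 1 2 0 (by simp [InMonIdeal]),
      hI' 2 0 1 (by simp [InMonIdeal]), hI' 1 0 2 (by simp [InMonIdeal]),
      hI' 0 2 1 (by simp [InMonIdeal]), hI' 0 1 2 (by simp [InMonIdeal])]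
    refine ⟨?_, ?_, ?_, ?_⟩
    · simp
      ring
    all_goals
      intro h1 h2
      simp [h1, h2]
  have hm (p q r : ℕ) (hs : p + q + r = 3) :
      (monomial (expVec p q r) (1 : K)).IsHomogeneous 3 :=
    isHomogeneous_monomial 1 (by simpa [degree_fin_three] using hs)
  have h1 := key _ (hm 2 1 0 rfl)
  have h2 := key _ (hm 1 0 2 rfl)
  have h3 := key _ (hm 0 2 1 rfl)
  simp [coeff_monomial, expVec_inj] at h1 h2 h3
  tauto

end

/-- **The almost complete intersection `A = K[X,Y,Z]/(X³,Y³,Z³,XYZ)` fails the Weak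
Lefschetz property**: `dim_K A_2 = dim_K A_3 = 6`, and for every linear form
`ℓ ∈ R_1` the multiplication map `μ_ℓ : A_2 → A_3` is neither injective nor
surjective; in particular `A` does not have WLP (negative answer to a question of
Migliore and Miró-Roig). -/
theorem monomial_aci_not_weakLefschetz
    {K : Type*} [Field K] [IsAlgClosed K] [CharZero K] :
    Module.finrank K (gradedPiece (K := K)
        (Ideal.span {X 0 ^ 3, X 1 ^ 3, X 2 ^ 3, X 0 * X 1 * X 2}) 2) = 6 ∧
    Module.finrank K (gradedPiece (K := K)
        (Ideal.span {X 0 ^ 3, X 1 ^ 3, X 2 ^ 3, X 0 * X 1 * X 2}) 3) = 6 ∧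
    (∀ ℓ : MvPolynomial (Fin 3) K, ℓ.IsHomogeneous 1 →
      ¬ LefInj (Ideal.span {X 0 ^ 3, X 1 ^ 3, X 2 ^ 3, X 0 * X 1 * X 2}) ℓ 2 ∧
      ¬ LefSurj (Ideal.span {X 0 ^ 3, X 1 ^ 3, X 2 ^ 3, X 0 * X 1 * X 2}) ℓ 2) ∧
    ¬ WeakLefschetz (Ideal.span {X 0 ^ 3, X 1 ^ 3, X 2 ^ 3, X 0 * X 1 * X 2} :
        Ideal (MvPolynomial (Fin 3) K)) := by
  have hℓ (ℓ : MvPolynomial (Fin 3) K) (h : ℓ.IsHomogeneous 1) :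
      ¬ LefInj (monIdeal K) ℓ 2 ∧ ¬ LefSurj (monIdeal K) ℓ 2 := by
    obtain ⟨a, b, c, rfl⟩ := exists_eq_linear_form h
    exact ⟨not_lefInj_monIdeal a b c, not_lefSurj_monIdeal a b c⟩
  refine ⟨finrank_gradedPiece_monIdeal_two, finrank_gradedPiece_monIdeal_three, hℓ, ?_⟩
  rintro ⟨ℓ, -, h, hw⟩
  exact (hw 2).elim (hℓ ℓ h).1 (hℓ ℓ h).2
end

section
/- Let K be a field and R = K[X,Y,Z]. For all u, v ∈ K one has the polynomial identity (uX + vY + Z)·(u^2 X^2 + v^2 Y^2 + Z^2 − uv·XY − u·XZ − v·YZ) = u^3 X^3 + v^3 Y^3 + Z^3 − 3uv·XYZ; in particular this product lies in the ideal (X^3, Y^3, Z^3, XYZ). Consequently, since the ideal (X^3, Y^3, Z^3, XYZ) contains no nonzero element of degree 2, the class of the quadric u^2 X^2 + v^2 Y^2 + Z^2 − uv·XY − u·XZ − v·YZ is a NONZERO element of the kernel of the multiplication map μ_ℓ : A_2 → A_3 for the linear form ℓ = uX + vY + Z, where A = R/(X^3, Y^3, Z^3, XYZ). -/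
open MvPolynomial

/-- Every element of `(X³, Y³, Z³, XYZ)` becomes divisible by `T³` under `X, Y ↦ 0`, `Z ↦ T`. -/
theorem X_pow_three_dvd_aeval_of_mem_span {K : Type*} [Field K] {p : MvPolynomial (Fin 3) K}
    (hp : p ∈ (Ideal.span {X 0 ^ 3, X 1 ^ 3, X 2 ^ 3, X 0 * X 1 * X 2} :
      Ideal (MvPolynomial (Fin 3) K))) :
    (Polynomial.X ^ 3 : Polynomial K) ∣ aeval ![0, 0, Polynomial.X] p := by
  rw [← Ideal.mem_span_singleton, ← AlgHom.coe_toRingHom, ← Ideal.mem_comap]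
  refine Ideal.span_le.mpr ?_ hp
  rintro q (rfl | rfl | rfl | rfl) <;> simp

/-- The key identity behind the counterexample: in `R = K[X,Y,Z]`, for all `u, v ∈ K`,
`(uX + vY + Z)·(u²X² + v²Y² + Z² − uv·XY − u·XZ − v·YZ) = u³X³ + v³Y³ + Z³ − 3uv·XYZ`,
so the product lies in `(X³, Y³, Z³, XYZ)`; the quadric itself does not lie in this
ideal, hence its class is a nonzero element of the kernel of
`μ_ℓ : A_2 → A_3` for `ℓ = uX + vY + Z`, where `A = R/(X³,Y³,Z³,XYZ)`. -/
theorem quadric_in_kernel {K : Type*} [Field K] (u v : K) :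
    (C u * X 0 + C v * X 1 + X 2) *
        (C (u ^ 2) * X 0 ^ 2 + C (v ^ 2) * X 1 ^ 2 + X 2 ^ 2
          - C (u * v) * (X 0 * X 1) - C u * (X 0 * X 2) - C v * (X 1 * X 2)) =
      C (u ^ 3) * X 0 ^ 3 + C (v ^ 3) * X 1 ^ 3 + X 2 ^ 3
        - C (3 * (u * v)) * (X 0 * X 1 * X 2) ∧
    (C u * X 0 + C v * X 1 + X 2) *
        (C (u ^ 2) * X 0 ^ 2 + C (v ^ 2) * X 1 ^ 2 + X 2 ^ 2
          - C (u * v) * (X 0 * X 1) - C u * (X 0 * X 2) - C v * (X 1 * X 2))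
      ∈ (Ideal.span {X 0 ^ 3, X 1 ^ 3, X 2 ^ 3, X 0 * X 1 * X 2} :
          Ideal (MvPolynomial (Fin 3) K)) ∧
    (C (u ^ 2) * X 0 ^ 2 + C (v ^ 2) * X 1 ^ 2 + X 2 ^ 2
          - C (u * v) * (X 0 * X 1) - C u * (X 0 * X 2) - C v * (X 1 * X 2))
      ∉ (Ideal.span {X 0 ^ 3, X 1 ^ 3, X 2 ^ 3, X 0 * X 1 * X 2} :
          Ideal (MvPolynomial (Fin 3) K)) := by
  have identity : ∀ {R : Type _} [CommRing R] (a b x y z : R),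
      (a * x + b * y + z) * (a ^ 2 * x ^ 2 + b ^ 2 * y ^ 2 + z ^ 2
        - a * b * (x * y) - a * (x * z) - b * (y * z)) =
      a ^ 3 * x ^ 3 + b ^ 3 * y ^ 3 + z ^ 3 - 3 * (a * b) * (x * y * z) := by
    intros; ring
  have C_three : ∀ {σ : Type}, (C 3 : MvPolynomial σ K) = 3 := map_ofNat C 3
  refine ⟨?_, ?_, fun h => ?_⟩
  · simp only [map_mul, map_pow, C_three]
    exact identity _ _ _ _ _
  · simp only [map_mul, map_pow, identity]
    refine sub_mem (add_mem (add_mem ?_ ?_) ?_) ?_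
    on_goal 3 => exact Ideal.subset_span (by simp)
    all_goals exact Ideal.mul_mem_left _ _ (Ideal.subset_span (by simp))
  · have hdvd := X_pow_three_dvd_aeval_of_mem_span h
    simpa using Polynomial.X_pow_dvd_iff.mp hdvd 2 (by norm_num)
end

section
/- Let K be a field of characteristic zero and R = K[X,Y,Z]. For all u, v, w ∈ K with u ≠ 0, v ≠ 0 and w ≠ 0, the monomial XYZ lies in the ideal (uX + vY + wZ, X^3, Y^3, Z^3) of R. Equivalently, for every such (general) linear form ℓ = uX + vY + wZ, the class of XYZ lies in the kernel of the natural map (R/(X^3,Y^3,Z^3))_3 → (R/(ℓ, X^3, Y^3, Z^3))_3 between degree-3 graded components. -/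
open MvPolynomial

/-- In characteristic zero, for any linear form `ℓ = uX + vY + wZ` with
`u, v, w ≠ 0`, the monomial `XYZ` lies in the ideal `(ℓ, X³, Y³, Z³)` of
`R = K[X,Y,Z]`; equivalently, the class of `XYZ` lies in the kernel of the natural
map `(R/(X³,Y³,Z³))_3 → (R/(ℓ,X³,Y³,Z³))_3`. -/
theorem xyz_mem_ideal_of_linear_form {K : Type*} [Field K] [CharZero K]
    (u v w : K) (hu : u ≠ 0) (hv : v ≠ 0) (hw : w ≠ 0) :
    X 0 * X 1 * X 2
      ∈ (Ideal.span {C u * X 0 + C v * X 1 + C w * X 2, X 0 ^ 3, X 1 ^ 3, X 2 ^ 3} :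
          Ideal (MvPolynomial (Fin 3) K)) := by
  set I : Ideal (MvPolynomial (Fin 3) K) :=
    Ideal.span {C u * X 0 + C v * X 1 + C w * X 2, X 0 ^ 3, X 1 ^ 3, X 2 ^ 3}
  have hl : C u * X 0 + C v * X 1 + C w * X 2 ∈ I := Ideal.subset_span (by simp)
  have hx : X 0 ^ 3 ∈ I := Ideal.subset_span (by simp)
  have hy : X 1 ^ 3 ∈ I := Ideal.subset_span (by simp)
  have hz : X 2 ^ 3 ∈ I := Ideal.subset_span (by simp)
  have hunit : IsUnit (C (3 * u * v * w) : MvPolynomial (Fin 3) K) :=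
    (IsUnit.mk0 (3 * u * v * w) (by simp [hu, hv, hw])).map C
  rw [← Ideal.unit_mul_mem_iff_mem I hunit]
  -- `a³ + b³ + c³ - 3abc` is divisible by `a + b + c`
  have key : C (3 * u * v * w) * (X 0 * X 1 * X 2) =
      C u ^ 3 * X 0 ^ 3 + C v ^ 3 * X 1 ^ 3 + C w ^ 3 * X 2 ^ 3 -
        ((C u * X 0) ^ 2 + (C v * X 1) ^ 2 + (C w * X 2) ^ 2 - C u * X 0 * (C v * X 1) -
          C v * X 1 * (C w * X 2) - C w * X 2 * (C u * X 0)) *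
        (C u * X 0 + C v * X 1 + C w * X 2 : MvPolynomial (Fin 3) K) := by
    simp only [map_mul, map_ofNat]
    ring
  rw [key]
  exact I.sub_mem (I.add_mem (I.add_mem (I.mul_mem_left _ hx) (I.mul_mem_left _ hy))
    (I.mul_mem_left _ hz)) (I.mul_mem_left _ hl)
end

section
/- Let K be an algebraically closed field of characteristic zero, R = K[X,Y,Z], and let f ∈ R be a homogeneous polynomial of degree 3 with f ∉ (X^3, Y^3, Z^3, XYZ). Then the Artinian algebra A = R/(X^3, Y^3, Z^3, f) has the Weak Lefschetz property. (Thus A = R/(X^3,Y^3,Z^3,XYZ) is the only counterexample to the Weak Lefschetz property among degree-3 almost complete intersections containing the monomials X^3, Y^3, Z^3.) -/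
open MvPolynomial

/-- A linear subspace containing all `X i * p` with `p` homogeneous of degree `n` contains all
homogeneous polynomials of degree `n + 1`. -/
theorem mem_of_forall_X_mul_mem {σ K : Type*} [Field K] (T : Submodule K (MvPolynomial σ K))
    {n : ℕ} (h : ∀ i (p : MvPolynomial σ K), p.IsHomogeneous n → X i * p ∈ T)
    {g : MvPolynomial σ K} (hg : g.IsHomogeneous (n + 1)) : g ∈ T := by
  rw [g.as_sum]
  refine Submodule.sum_mem _ fun d hd => ?_
  have hdeg : d.degree = n + 1 := by
    have := hg (mem_support_iff.mp hd)
    rwa [Finsupp.degree_eq_weight_one]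
  obtain ⟨i, hi⟩ : ∃ i, d i ≠ 0 := by
    by_contra! h0
    have : d = 0 := Finsupp.ext h0
    simp [this] at hdeg
  have hle : Finsupp.single i 1 ≤ d := by
    rw [Finsupp.single_le_iff]
    omega
  have hd' : d = Finsupp.single i 1 + (d - Finsupp.single i 1) := (add_tsub_cancel_of_le hle).symm
  have hdeg' : (d - Finsupp.single i 1).degree = n := by
    have := congrArg Finsupp.degree hd'
    rw [map_add, hdeg, Finsupp.degree_single] at this
    omega
  have := h i _ (isHomogeneous_monomial (coeff d g) hdeg')
  rwa [X, monomial_mul, one_mul, ← hd'] at this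

/-- A linear subspace containing all products of three variables contains all cubic forms. -/
theorem mem_of_forall_X_mul_X_mul_X_mem {σ K : Type*} [Field K]
    (T : Submodule K (MvPolynomial σ K))
    (h : ∀ i j k, (X i * (X j * X k) : MvPolynomial σ K) ∈ T)
    {g : MvPolynomial σ K} (hg : g.IsHomogeneous 3) : g ∈ T := by
  have h3 : ∀ i j k (r : MvPolynomial σ K), r.IsHomogeneous 0 → X i * (X j * (X k * r)) ∈ T := by
    intro i j k r hr
    rw [totalDegree_eq_zero_iff_eq_C.mp ((totalDegree_zero_iff_isHomogeneous _).mpr hr)]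
    generalize coeff 0 r = c
    have := T.smul_mem c (h i j k)
    rw [smul_eq_C_mul] at this
    convert this using 1
    ring
  have h2 : ∀ i j (q : MvPolynomial σ K), q.IsHomogeneous 1 → X i * (X j * q) ∈ T := by
    intro i j q hq
    have : q ∈ T.comap (LinearMap.mulLeft K (X i * X j)) :=
      mem_of_forall_X_mul_mem (n := 0) _
        (fun k r hr => by simpa [mul_assoc] using h3 i j k r hr) hq
    simpa [mul_assoc] using this
  have h1 : ∀ i (p : MvPolynomial σ K), p.IsHomogeneous 2 → X i * p ∈ T := by
    intro i p hp
    have : p ∈ T.comap (LinearMap.mulLeft K (X i)) :=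
      mem_of_forall_X_mul_mem (n := 1) _ (fun j q hq => by simpa using h2 i j q hq) hp
    simpa using this
  exact mem_of_forall_X_mul_mem (n := 2) T h1 hg

/-- The subspace of those `g` which lie in `I + ℓ R_m`. -/
def imageMod {K : Type*} [Field K] (I : Ideal (MvPolynomial (Fin 3) K))
    (ℓ : MvPolynomial (Fin 3) K) (m : ℕ) : Submodule K (MvPolynomial (Fin 3) K) where
  carrier := {g | ∃ h : MvPolynomial (Fin 3) K, h.IsHomogeneous m ∧ g - ℓ * h ∈ I}
  zero_mem' := ⟨0, isHomogeneous_zero _ _ _, by simp⟩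
  add_mem' := by
    rintro g g' ⟨h, hh, hI⟩ ⟨h', hh', hI'⟩
    refine ⟨h + h', hh.add hh', ?_⟩
    convert I.add_mem hI hI' using 1
    ring
  smul_mem' := by
    rintro c g ⟨h, hh, hI⟩
    refine ⟨C c * h, by simpa using (isHomogeneous_C _ c).mul hh, ?_⟩
    convert I.mul_mem_left (C c) hI using 1
    rw [smul_eq_C_mul]
    ring

theorem mem_imageMod_of_mem {K : Type*} [Field K] {I : Ideal (MvPolynomial (Fin 3) K)}
    {ℓ : MvPolynomial (Fin 3) K} {m : ℕ} {g : MvPolynomial (Fin 3) K} (hg : g ∈ I) :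
    g ∈ imageMod I ℓ m :=
  ⟨0, isHomogeneous_zero _ _ _, by simpa using hg⟩

theorem mul_mem_imageMod {K : Type*} [Field K] {I : Ideal (MvPolynomial (Fin 3) K)}
    {ℓ : MvPolynomial (Fin 3) K} {m : ℕ} {h : MvPolynomial (Fin 3) K} (hh : h.IsHomogeneous m) :
    ℓ * h ∈ imageMod I ℓ m :=
  ⟨h, hh, by simp⟩

/-- Surjectivity of multiplication by `ℓ` propagates to higher degrees. -/
theorem LefSurj.succ {K : Type*} [Field K] {I : Ideal (MvPolynomial (Fin 3) K)}
    {ℓ : MvPolynomial (Fin 3) K} {m : ℕ} (hs : LefSurj I ℓ m) : LefSurj I ℓ (m + 1) := by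
  intro g hg
  refine mem_of_forall_X_mul_mem (imageMod I ℓ (m + 1)) (fun i p hp => ?_) hg
  obtain ⟨h, hh, hI⟩ := hs p hp
  refine ⟨X i * h, by simpa [add_comm] using (isHomogeneous_X K i).mul hh, ?_⟩
  convert I.mul_mem_left (X i) hI using 1
  ring

/-- Multiplication by `ℓ` is injective in degrees `m` with `m + 1 < n` when `I` is generated by
forms of degree `n`. -/
theorem lefInj_of_forall_isHomogeneous {K : Type*} [Field K] {S : Set (MvPolynomial (Fin 3) K)}
    {n m : ℕ} (hS : ∀ s ∈ S, s.IsHomogeneous n) {ℓ : MvPolynomial (Fin 3) K} (hℓ0 : ℓ ≠ 0)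
    (hℓ : ℓ.IsHomogeneous 1) (hm : m + 1 < n) : LefInj (Ideal.span S) ℓ m := by
  intro h hh hI
  have hle : Ideal.span S ≤ idealOfVars (Fin 3) K ^ n := by
    rw [Ideal.span_le]
    intro s hs
    rw [SetLike.mem_coe, mem_pow_idealOfVars_iff]
    intro d hd
    have := hS s hs (mem_support_iff.mp hd)
    rw [Finsupp.degree_eq_weight_one]
    exact this.ge
  have h0 : ℓ * h = 0 := by
    by_contra hne
    obtain ⟨d, hd⟩ := support_nonempty.mpr hne
    have h1 := (mem_pow_idealOfVars_iff _ _).mp (hle hI) d hd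
    have h2 : d.degree = 1 + m := by
      rw [Finsupp.degree_eq_weight_one]
      exact (hℓ.mul hh) (mem_support_iff.mp hd)
    omega
  rcases mul_eq_zero.mp h0 with h0 | h0
  · exact absurd h0 hℓ0
  · simp [h0]

/-- A ternary cubic form is a combination of the ten cubic monomials. -/
theorem exists_eq_of_isHomogeneous_three {K : Type*} [Field K] {f : MvPolynomial (Fin 3) K}
    (hf : f.IsHomogeneous 3) : ∃ e₀ e₁ e₂ d c₁ c₂ c₃ c₄ c₅ c₆ : K,
      f = C e₀ * X 0 ^ 3 + C e₁ * X 1 ^ 3 + C e₂ * X 2 ^ 3 + C d * (X 0 * X 1 * X 2)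
        + C c₁ * (X 0 ^ 2 * X 1) + C c₂ * (X 0 ^ 2 * X 2) + C c₃ * (X 0 * X 1 ^ 2)
        + C c₄ * (X 1 ^ 2 * X 2) + C c₅ * (X 0 * X 2 ^ 2) + C c₆ * (X 1 * X 2 ^ 2) := by
  have key : f ∈ Submodule.span K ({X 0 ^ 3, X 1 ^ 3, X 2 ^ 3, X 0 * X 1 * X 2, X 0 ^ 2 * X 1,
      X 0 ^ 2 * X 2, X 0 * X 1 ^ 2, X 1 ^ 2 * X 2, X 0 * X 2 ^ 2, X 1 * X 2 ^ 2} :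
      Set (MvPolynomial (Fin 3) K)) := by
    refine mem_of_forall_X_mul_X_mul_X_mem _ (fun i j k => Submodule.subset_span ?_) hf
    simp only [Set.mem_insert_iff, Set.mem_singleton_iff]
    fin_cases i <;> fin_cases j <;> fin_cases k <;>
      simp only [Fin.zero_eta, Fin.mk_one, Fin.reduceFinMk] <;> grind
  simp only [Submodule.mem_span_insert, Submodule.mem_span_singleton] at key
  obtain ⟨e₀, _, ⟨e₁, _, ⟨e₂, _, ⟨d, _, ⟨c₁, _, ⟨c₂, _, ⟨c₃, _, ⟨c₄, _, ⟨c₅, _, ⟨c₆, rfl⟩,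
    rfl⟩, rfl⟩, rfl⟩, rfl⟩, rfl⟩, rfl⟩, rfl⟩, rfl⟩, rfl⟩ := key
  refine ⟨e₀, e₁, e₂, d, c₁, c₂, c₃, c₄, c₅, c₆, ?_⟩
  simp only [smul_eq_C_mul]
  ring

/-- The determinant controlling surjectivity of `Z - aX - bY` from degree two to degree three is
nonzero for some `a` and `b`. -/
theorem exists_det_ne_zero {K : Type*} [Field K] [CharZero K] {c₁ c₂ c₃ c₄ c₅ c₆ : K}
    (h : ¬ (c₁ = 0 ∧ c₂ = 0 ∧ c₃ = 0 ∧ c₄ = 0 ∧ c₅ = 0 ∧ c₆ = 0)) :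
    ∃ a b : K, a ≠ 0 ∧ b ≠ 0 ∧
      c₃ * a + c₄ * a ^ 2 - c₅ * a * b ^ 2 + c₆ * a ^ 2 * b - c₁ * b - c₂ * b ^ 2 ≠ 0 := by
  by_contra! H
  apply h
  have h1 := H 1 1 (by norm_num) (by norm_num)
  have h2 := H (-1) (-1) (by norm_num) (by norm_num)
  have h3 := H 1 2 (by norm_num) (by norm_num)
  have h4 := H (-1) (-2) (by norm_num) (by norm_num)
  have h5 := H 1 (-1) (by norm_num) (by norm_num)
  have h6 := H 2 1 (by norm_num) (by norm_num)
  refine ⟨?_, ?_, ?_, ?_, ?_, ?_⟩ <;> grind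

/-- If a linear map kills `X³, Y³, Z³`, the multiples of `ℓ = Z - aX - bY` by quadratic monomials
and a cubic form `f` for which the determinant is nonzero, it kills all cubic forms. -/
theorem map_eq_zero_of_det_ne_zero {K V : Type*} [Field K] [CharZero K] [AddCommGroup V] [Module K V]
    (φ : MvPolynomial (Fin 3) K →ₗ[K] V) {a b d c₁ c₂ c₃ c₄ c₅ c₆ : K}
    (ha : a ≠ 0) (hb : b ≠ 0)
    (hD : c₃ * a + c₄ * a ^ 2 - c₅ * a * b ^ 2 + c₆ * a ^ 2 * b - c₁ * b - c₂ * b ^ 2 ≠ 0)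
    (hcube : ∀ i : Fin 3, φ (X i ^ 3) = 0)
    (hmul : ∀ i j : Fin 3, φ ((X 2 - C a * X 0 - C b * X 1) * (X i * X j)) = 0)
    (hf : φ (C d * (X 0 * X 1 * X 2)
        + C c₁ * (X 0 ^ 2 * X 1) + C c₂ * (X 0 ^ 2 * X 2) + C c₃ * (X 0 * X 1 ^ 2)
        + C c₄ * (X 1 ^ 2 * X 2) + C c₅ * (X 0 * X 2 ^ 2) + C c₆ * (X 1 * X 2 ^ 2)) = 0)
    {g : MvPolynomial (Fin 3) K} (hg : g.IsHomogeneous 3) : φ g = 0 := by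
  have smul_C : ∀ (c : K) (p : MvPolynomial (Fin 3) K), φ (C c * p) = c • φ p :=
    fun c p => by rw [← smul_eq_C_mul, map_smul]
  have hZ : ∀ i j : Fin 3, φ (X i * X j * X 2) =
      a • φ (X i * X j * X 0) + b • φ (X i * X j * X 1) := by
    intro i j
    have h := hmul i j
    rw [show (X 2 - C a * X 0 - C b * X 1) * (X i * X j) = X i * X j * X 2
      - C a * (X i * X j * X 0) - C b * (X i * X j * X 1) by ring, map_sub, map_sub, smul_C,
      smul_C] at h
    rw [← sub_eq_zero, ← h]
    abel
  have comm : ∀ i j k : Fin 3, φ (X i * X j * X k) = φ (X i * X k * X j) :=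
    fun i j k => congrArg φ (by ring)
  have comm' : ∀ i j k : Fin 3, φ (X i * X j * X k) = φ (X j * X i * X k) :=
    fun i j k => congrArg φ (by ring)
  have h000 : φ (X 0 * X 0 * X 0) = 0 :=
    (congrArg φ (by ring)).trans (hcube 0)
  have h111 : φ (X 1 * X 1 * X 1) = 0 :=
    (congrArg φ (by ring)).trans (hcube 1)
  have h222 : φ (X 2 * X 2 * X 2) = 0 :=
    (congrArg φ (by ring)).trans (hcube 2)
  simp only [map_add, smul_C] at hf
  simp only [sq, ← mul_assoc] at hf
  have h110 : φ (X 1 * X 1 * X 0) = φ (X 0 * X 1 * X 1) := congrArg φ (by ring)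
  have h010 : φ (X 0 * X 1 * X 0) = φ (X 0 * X 0 * X 1) := congrArg φ (by ring)
  have h002 := hZ 0 0
  have h012 := hZ 0 1
  have h112 := hZ 1 1
  have h022 := hZ 0 2
  have h122 := hZ 1 2
  rw [comm 0 2 0, comm 0 2 1] at h022
  rw [comm 1 2 0, comm 1 2 1, comm' 1 0 2] at h122
  have hc := hZ 2 2
  rw [h222, comm 2 2 0, comm' 2 0 2, comm 2 2 1, comm' 2 1 2] at hc
  simp only [h000, h111, h110, h010, smul_zero, zero_add, add_zero] at h002 h012 h112
  rw [h002, h012] at h022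
  rw [h012, h112] at h122
  rw [h022, h122] at hc
  rw [h002, h012, h112, h022, h122] at hf
  set u := φ (X 0 * X 0 * X 1) with hu
  set v := φ (X 0 * X 1 * X 1) with hv
  have hab : a • u + b • v = 0 := by
    have h3 : (3 * a * b) • (a • u + b • v) = 0 := by
      rw [hc]
      module
    exact (smul_eq_zero.mp h3).resolve_left (by simp [ha, hb])
  have hv0 : v = 0 := by
    refine (smul_eq_zero.mp ?_).resolve_left hD
    linear_combination (norm := module) a • hf - (c₁ + c₂ * b + c₅ * (2 * a * b) + c₆ * a ^ 2 + d * a) • hab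
  have hu0 : u = 0 := by
    rw [hv0, smul_zero, add_zero] at hab
    exact (smul_eq_zero.mp hab).resolve_left ha
  obtain ⟨e₀, e₁, e₂, d', c₁', c₂', c₃', c₄', c₅', c₆', rfl⟩ := exists_eq_of_isHomogeneous_three hg
  simp only [map_add, smul_C, hcube]
  simp only [sq, ← mul_assoc]
  simp only [← hu, ← hv, h002, h012, h112, h022, h122, hu0, hv0, smul_zero, add_zero]

/-- **`(X³,Y³,Z³,XYZ)` is the only counterexample in degree 3 containing
`X³, Y³, Z³`**: over an algebraically closed field of characteristic zero, if `f` is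
homogeneous of degree `3` with `f ∉ (X³, Y³, Z³, XYZ)`, then the Artinian algebra
`A = K[X,Y,Z]/(X³, Y³, Z³, f)` has the Weak Lefschetz property. -/
theorem weakLefschetz_of_not_mem
    {K : Type*} [Field K] [IsAlgClosed K] [CharZero K]
    (f : MvPolynomial (Fin 3) K) (hf : f.IsHomogeneous 3)
    (hnotmem : f ∉ (Ideal.span {X 0 ^ 3, X 1 ^ 3, X 2 ^ 3, X 0 * X 1 * X 2} :
        Ideal (MvPolynomial (Fin 3) K))) :
    WeakLefschetz (Ideal.span {X 0 ^ 3, X 1 ^ 3, X 2 ^ 3, f}) := by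
  obtain ⟨e₀, e₁, e₂, d, c₁, c₂, c₃, c₄, c₅, c₆, hfe⟩ := exists_eq_of_isHomogeneous_three hf
  obtain ⟨a, b, ha, hb, hD⟩ : ∃ a b : K, a ≠ 0 ∧ b ≠ 0 ∧
      c₃ * a + c₄ * a ^ 2 - c₅ * a * b ^ 2 + c₆ * a ^ 2 * b - c₁ * b - c₂ * b ^ 2 ≠ 0 := by
    refine exists_det_ne_zero fun ⟨h1, h2, h3, h4, h5, h6⟩ => hnotmem ?_
    rw [hfe, h1, h2, h3, h4, h5, h6]
    simp only [C_0, zero_mul, add_zero]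
    refine Ideal.add_mem _ (Ideal.add_mem _ (Ideal.add_mem _ ?_ ?_) ?_) ?_ <;>
      exact Ideal.mul_mem_left _ _ (Ideal.subset_span (by simp))
  set I : Ideal (MvPolynomial (Fin 3) K) := Ideal.span {X 0 ^ 3, X 1 ^ 3, X 2 ^ 3, f} with hI
  have hX : ∀ i : Fin 3, (X i : MvPolynomial (Fin 3) K).IsHomogeneous 1 := isHomogeneous_X K
  have hXX : ∀ i j : Fin 3, (X i * X j : MvPolynomial (Fin 3) K).IsHomogeneous 2 :=
    fun i j => (hX i).mul (hX j)
  have hC : ∀ (c : K) (i : Fin 3), (C c * X i : MvPolynomial (Fin 3) K).IsHomogeneous 1 :=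
    fun c i => by simpa using (isHomogeneous_C _ c).mul (hX i)
  let ℓ : MvPolynomial (Fin 3) K := X 2 - C a * X 0 - C b * X 1
  have hℓ : ℓ.IsHomogeneous 1 := ((hX 2).sub (hC a 0)).sub (hC b 1)
  have hℓ0 : ℓ ≠ 0 := by
    intro h
    have := congrArg (eval ![0, 0, 1]) h
    simp [ℓ] at this
  have hsurj : LefSurj I ℓ 2 := by
    have hcube : ∀ i : Fin 3, (X i ^ 3 : MvPolynomial (Fin 3) K) ∈ I := fun i =>
      Ideal.subset_span (by fin_cases i <;> simp)
    have hfI : f ∈ I := Ideal.subset_span (by simp)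
    refine fun g hg => (Submodule.Quotient.mk_eq_zero (imageMod I ℓ 2)).mp
      (map_eq_zero_of_det_ne_zero (imageMod I ℓ 2).mkQ (d := d) ha hb hD
      (fun i => (Submodule.Quotient.mk_eq_zero _).mpr (mem_imageMod_of_mem (hcube i)))
      (fun i j => (Submodule.Quotient.mk_eq_zero _).mpr (mul_mem_imageMod (hXX i j)))
      ((Submodule.Quotient.mk_eq_zero _).mpr (mem_imageMod_of_mem ?_)) hg)
    convert I.sub_mem hfI (I.add_mem (I.add_mem (I.mul_mem_left (C e₀) (hcube 0))
      (I.mul_mem_left (C e₁) (hcube 1))) (I.mul_mem_left (C e₂) (hcube 2))) using 1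
    rw [hfe]
    ring
  refine ⟨ℓ, hℓ0, hℓ, fun m => ?_⟩
  rcases lt_or_ge m 2 with hm | hm
  · refine Or.inl (lefInj_of_forall_isHomogeneous (n := 3) ?_ hℓ0 hℓ (by omega))
    rintro s (rfl | rfl | rfl | rfl)
    · exact isHomogeneous_X_pow _ _
    · exact isHomogeneous_X_pow _ _
    · exact isHomogeneous_X_pow _ _
    · exact hf
  · exact Or.inr (Nat.le_induction hsurj (fun _ _ ih => ih.succ) m hm)
end

section
/- (Non-lifting syzygies force non-injectivity; the algebraic mechanism behind Theorem 2.2(2) and the counterexample.) Let K be a field, R = K[X,Y,Z], and let f_1, …, f_n ∈ R be homogeneous of degrees d_1, …, d_n with I = (f_1, …, f_n) R_+-primary; set A = R/I. Let α, β ∈ K, ℓ = Z − αX − βY, and g_i(X,Y) = f_i(X, Y, αX + βY) ∈ K[X,Y]. Fix an integer m and assume: (i) there is no nonzero tuple (h_1, …, h_n) with each h_i ∈ R homogeneous of degree m+1−d_i and Σ h_i f_i = 0 (no global syzygy in total degree m+1); and (ii) there exists a nonzero tuple (h̃_1, …, h̃_n) with each h̃_i ∈ K[X,Y] homogeneous of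 degree m+1−d_i and Σ h̃_i g_i = 0 (a syzygy of the restrictions to the line in total degree m+1). Then the multiplication map μ_ℓ : A_m → A_{m+1} is not injective. -/
open MvPolynomial

/-- A tuple `(h₁,…,hₙ)` of polynomials (in any number of variables) is homogeneous of
(total) degree `m` with respect to the degree vector `d`: each `hᵢ` is homogeneous of
degree `m − dᵢ` (and `hᵢ = 0` when `m < dᵢ`). -/
def TupleIsHomogeneous {K : Type*} [Field K] {σ : Type*} {n : ℕ} (d : Fin n → ℕ)
    (h : Fin n → MvPolynomial σ K) (m : ℕ) : Prop :=
  ∀ i, if d i ≤ m then (h i).IsHomogeneous (m - d i) else h i = 0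

namespace MvPolynomial

section

variable {σ R : Type*} [CommSemiring R]

/-- Homogeneous components of a product whose right factor is homogeneous. -/
lemma homogeneousComponent_mul_of_isHomogeneous_right {p q : MvPolynomial σ R} {k : ℕ}
    (hq : q.IsHomogeneous k) (m : ℕ) :
    homogeneousComponent m (p * q) =
      if k ≤ m then homogeneousComponent (m - k) p * q else 0 := by
  let _ : GradedAlgebra (homogeneousSubmodule σ R) := gradedAlgebra
  have hdec (i : ℕ) (φ : MvPolynomial σ R) :
      (DirectSum.decompose (homogeneousSubmodule σ R) φ i : MvPolynomial σ R) =
        homogeneousComponent i φ :=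
    decomposition.decompose'_apply φ i
  rw [← hdec, ← hdec]
  exact DirectSum.coe_decompose_mul_of_right_mem (homogeneousSubmodule σ R) m
    ((mem_homogeneousSubmodule k q).2 hq)

end

section

variable {K : Type*} [CommRing K]

/-- The equation `Z - αX - βY` of a line. -/
noncomputable def lineForm (α β : K) : MvPolynomial (Fin 3) K :=
  X 2 - C α * X 0 - C β * X 1

/-- Restriction of polynomials to the line `Z = αX + βY`. -/
noncomputable def restrictToLine (α β : K) :
    MvPolynomial (Fin 3) K →ₐ[K] MvPolynomial (Fin 2) K :=
  aeval ![X 0, X 1, C α * X 0 + C β * X 1]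

lemma isHomogeneous_lineForm (α β : K) : (lineForm α β).IsHomogeneous 1 :=
  ((isHomogeneous_X K 2).sub ((isHomogeneous_X K 0).C_mul α)).sub ((isHomogeneous_X K 1).C_mul β)

lemma restrictToLine_lineForm (α β : K) : restrictToLine α β (lineForm α β) = 0 := by
  simp [restrictToLine, lineForm, ← algebraMap_eq]

lemma restrictToLine_rename (α β : K) (p : MvPolynomial (Fin 2) K) :
    restrictToLine α β (rename Fin.castSucc p) = p := by
  have h : (restrictToLine α β).comp (rename Fin.castSucc) = AlgHom.id K _ := by
    ext i : 1
    fin_cases i <;> simp [restrictToLine]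
  exact DFunLike.congr_fun h p

/-- A polynomial vanishing on a line is divisible by the equation of the line. -/
lemma lineForm_dvd_of_restrictToLine_eq_zero {α β : K} {p : MvPolynomial (Fin 3) K}
    (hp : restrictToLine α β p = 0) : lineForm α β ∣ p := by
  let π := Ideal.Quotient.mkₐ K (Ideal.span {lineForm α β})
  have h : π.comp ((rename Fin.castSucc).comp (restrictToLine α β)) = π := by
    ext i : 1
    fin_cases i
    · simp [restrictToLine]
    · simp [restrictToLine]
    · refine Eq.symm (Ideal.Quotient.eq.2 ?_)
      convert Ideal.mem_span_singleton_self (lineForm α β) using 1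
      simp [restrictToLine, lineForm, algebraMap_eq]
      ring
  have h' : π p = 0 := by
    rw [← h]
    simp [hp]
  exact Ideal.mem_span_singleton.1 (Ideal.Quotient.eq_zero_iff_mem.1 h')

end

end MvPolynomial

section

variable {K σ : Type*} [Field K] {n : ℕ} {d : Fin n → ℕ} {m : ℕ}

/-- A homogeneous member of an ideal generated by homogeneous elements is a combination of the
generators with homogeneous coefficients. -/
lemma exists_tupleIsHomogeneous_of_mem_span {f : Fin n → MvPolynomial σ K}
    (hf : ∀ i, (f i).IsHomogeneous (d i)) {q : MvPolynomial σ K} (hq : q.IsHomogeneous m)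
    (hmem : q ∈ Ideal.span (Set.range f)) :
    ∃ c : Fin n → MvPolynomial σ K, TupleIsHomogeneous d c m ∧ ∑ i, c i * f i = q := by
  obtain ⟨c, rfl⟩ := Ideal.mem_span_range_iff_exists_fun.1 hmem
  refine ⟨fun i => if d i ≤ m then homogeneousComponent (m - d i) (c i) else 0, fun i => ?_, ?_⟩
  · dsimp only
    split_ifs
    exacts [homogeneousComponent_isHomogeneous _ _, rfl]
  · conv_rhs => rw [← homogeneousComponent_eq_self hq, map_sum]
    refine Finset.sum_congr rfl fun i _ => ?_
    rw [homogeneousComponent_mul_of_isHomogeneous_right (hf i), ite_mul, zero_mul]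

lemma TupleIsHomogeneous.sub {h h' : Fin n → MvPolynomial σ K}
    (hh : TupleIsHomogeneous d h m) (hh' : TupleIsHomogeneous d h' m) :
    TupleIsHomogeneous d (h - h') m := by
  intro i
  have h₁ := hh i
  have h₂ := hh' i
  split_ifs at h₁ h₂ ⊢
  · exact h₁.sub h₂
  · simp [h₁, h₂]

lemma TupleIsHomogeneous.rename {τ : Type*} {h : Fin n → MvPolynomial σ K}
    (hh : TupleIsHomogeneous d h m) (e : σ → τ) :
    TupleIsHomogeneous d (fun i => MvPolynomial.rename e (h i)) m := by
  intro i
  have h₁ := hh i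
  split_ifs at h₁ ⊢
  · exact h₁.rename_isHomogeneous
  · simp [h₁]

lemma TupleIsHomogeneous.linear_mul {h : Fin n → MvPolynomial σ K} {l : MvPolynomial σ K}
    (hh : TupleIsHomogeneous d h m) (hl : l.IsHomogeneous 1) :
    TupleIsHomogeneous d (fun i => l * h i) (m + 1) := by
  intro i
  have h₁ := hh i
  by_cases hi : d i ≤ m
  · rw [if_pos hi] at h₁
    rw [if_pos (by lia), show m + 1 - d i = 1 + (m - d i) by lia]
    exact hl.mul h₁
  · rw [if_neg hi] at h₁
    simp [h₁, isHomogeneous_zero]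

lemma TupleIsHomogeneous.sum_mul {h f : Fin n → MvPolynomial σ K}
    (hh : TupleIsHomogeneous d h m) (hf : ∀ i, (f i).IsHomogeneous (d i)) :
    (∑ i, h i * f i).IsHomogeneous m := by
  refine IsHomogeneous.sum _ _ _ fun i _ => ?_
  have h₁ := hh i
  split_ifs at h₁ with hi
  · simpa [Nat.sub_add_cancel hi] using h₁.mul (hf i)
  · simp [h₁, isHomogeneous_zero]

end

/-- **Non-lifting syzygies force non-injectivity** (the algebraic mechanism behind
Theorem 2.2(2) and the counterexample): let `f₁,…,fₙ ∈ R = K[X,Y,Z]` be homogeneous of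
degrees `d₁,…,dₙ` generating an `R₊`-primary ideal `I`, let `ℓ = Z − αX − βY` and
`gᵢ = fᵢ(X, Y, αX + βY) ∈ K[X,Y]`.  If there is no nonzero global syzygy of
`f₁,…,fₙ` in total degree `m+1`, but there is a nonzero syzygy of the restrictions
`g₁,…,gₙ` in total degree `m+1`, then the multiplication map `μ_ℓ : A_m → A_{m+1}` on
`A = R/I` is not injective, i.e. there is a homogeneous `q` of degree `m` with
`q ∉ I` and `ℓ·q ∈ I`. -/
theorem not_injective_of_nonlifting_syzygy
    {K : Type*} [Field K] {n : ℕ}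
    (f : Fin n → MvPolynomial (Fin 3) K) (d : Fin n → ℕ)
    (hf : ∀ i, (f i).IsHomogeneous (d i))
    (hprimary : (Ideal.span (Set.range f)).radical = Ideal.span {X 0, X 1, X 2})
    (α β : K) (m : ℕ)
    (hglobal : ¬ ∃ h : Fin n → MvPolynomial (Fin 3) K, h ≠ 0 ∧
      TupleIsHomogeneous d h (m + 1) ∧ ∑ i, h i * f i = 0)
    (hrestricted : ∃ h : Fin n → MvPolynomial (Fin 2) K, h ≠ 0 ∧
      TupleIsHomogeneous d h (m + 1) ∧
      ∑ i, h i * (aeval (![X 0, X 1, C α * X 0 + C β * X 1] :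
        Fin 3 → MvPolynomial (Fin 2) K) (f i)) = 0) :
    ∃ q : MvPolynomial (Fin 3) K, q.IsHomogeneous m ∧
      q ∉ Ideal.span (Set.range f) ∧
      (X 2 - C α * X 0 - C β * X 1) * q ∈ Ideal.span (Set.range f) := by
  obtain ⟨h, hne, hh, hsyz⟩ := hrestricted
  change ∑ i, h i * restrictToLine α β (f i) = 0 at hsyz
  set H : Fin n → MvPolynomial (Fin 3) K := fun i => rename Fin.castSucc (h i)
  have hH : TupleIsHomogeneous d H (m + 1) := hh.rename _
  have hvanish : restrictToLine α β (∑ i, H i * f i) = 0 := by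
    simpa [H, restrictToLine_rename] using hsyz
  obtain ⟨p, hp⟩ := lineForm_dvd_of_restrictToLine_eq_zero hvanish
  have hlq : lineForm α β * homogeneousComponent m p = ∑ i, H i * f i := by
    rw [← homogeneousComponent_eq_self (hH.sum_mul hf), hp, mul_comm _ p,
      homogeneousComponent_mul_of_isHomogeneous_right (isHomogeneous_lineForm α β),
      if_pos (by lia), Nat.add_sub_cancel, mul_comm]
  refine ⟨homogeneousComponent m p, homogeneousComponent_isHomogeneous _ _, fun hmem => ?_, ?_⟩
  · obtain ⟨c, hc, hcq⟩ :=
      exists_tupleIsHomogeneous_of_mem_span hf (homogeneousComponent_isHomogeneous _ _) hmem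
    have hzero : H - (fun i => lineForm α β * c i) = 0 := by
      by_contra hnz
      refine hglobal ⟨_, hnz, hH.sub (hc.linear_mul (isHomogeneous_lineForm α β)), ?_⟩
      simp only [Pi.sub_apply, sub_mul, Finset.sum_sub_distrib, mul_assoc, ← Finset.mul_sum]
      rw [hcq, hlq, sub_self]
    refine hne (funext fun i => ?_)
    have hi : H i = lineForm α β * c i := congr_fun (sub_eq_zero.1 hzero) i
    rw [← restrictToLine_rename α β (h i), show rename Fin.castSucc (h i) = _ from hi, map_mul,
      restrictToLine_lineForm, zero_mul, Pi.zero_apply]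
  · change lineForm α β * homogeneousComponent m p ∈ _
    rw [hlq]
    exact Ideal.sum_mem _ fun i _ =>
      Ideal.mul_mem_left _ _ (Ideal.subset_span (Set.mem_range_self i))
end
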